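/- Interpolation estimates for the time derivatives of the third-order expansion coefficients (estimate (5.13), part of Lemma 5.6 of the paper, in conditional form): Let α ∈ (0,1), let k ≥ 10 be an integer, and let C₀ > 0. Suppose v : ℝ^d × ℝ → ℝ is smooth and for every t ≥ 1 satisfies (i) sup_{Q_ρ(t)} |v| ≤ C₀ e^{−(6+α)(1 − 2/(12+α))t/2}, (ii) [𝔇⁸v]_{α,Q_ρ(t)} ≤ C₀ e^{−t}, and (iii) [𝔇^ℓ v]_{α,Q_ρ(t)} ≤ C₀ e^{(ℓ−10)t/2} for every integer 8 ≤ ℓ ≤ 2k+10. Then there exist β ∈ (0, α) and C > 0 such that for every t ≥ 1: sup_{Q_{ρ′}(t)} |𝔇^ℓ v| ≤ C e^{−(t/2)(5 + β − (3+β)ℓ/(8+α))} for every integer 0 ≤ ℓ ≤ 8, and sup_{Q_{ρ′}(t)} |𝔇^ℓ v| ≤ C e^{−(t/2)(5 − (ℓ(ℓ−5) − αβ)/(ℓ+α))} for every integer 8 ≤ ℓ ≤ 2k+10. -/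

import Mathlib

open Real Finset

/-- The `p`-th spatial Fréchet derivative of the `q`-th time derivative of
`u : ℝ^d × ℝ → ℝ` (space is the first variable, time the second). -/
noncomputable def spaceTimeDeriv (d : ℕ) (u : EuclideanSpace ℝ (Fin d) × ℝ → ℝ)
    (p q : ℕ) (x : EuclideanSpace ℝ (Fin d)) (s : ℝ) :
    ContinuousMultilinearMap ℝ (fun _ : Fin p => EuclideanSpace ℝ (Fin d)) ℝ :=
  iteratedFDeriv ℝ p (fun y => iteratedDeriv q (fun τ => u (y, τ)) s) x

/-- `|𝔇^k u (z)| = sqrt (Σ_{p+2q=k} ‖D_x^p ∂_t^q u(z)‖²)`. -/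
noncomputable def frakDNorm (d : ℕ) (u : EuclideanSpace ℝ (Fin d) × ℝ → ℝ)
    (k : ℕ) (z : EuclideanSpace ℝ (Fin d) × ℝ) : ℝ :=
  Real.sqrt (∑ q ∈ Finset.range (k / 2 + 1), ‖spaceTimeDeriv d u (k - 2 * q) q z.1 z.2‖ ^ 2)

/-- The parabolic cylinder `Q_ρ(t) = {(x,s) : |x| ≤ ρ, t-1 ≤ s ≤ t}`. -/
def parabolicCylinder (d : ℕ) (ρ t : ℝ) : Set (EuclideanSpace ℝ (Fin d) × ℝ) :=
  {z | ‖z.1‖ ≤ ρ ∧ t - 1 ≤ z.2 ∧ z.2 ≤ t}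

/-- The parabolic distance `|x-x'| + |s-s'|^{1/2}`. -/
noncomputable def parabolicDist (d : ℕ) (z w : EuclideanSpace ℝ (Fin d) × ℝ) : ℝ :=
  ‖z.1 - w.1‖ + |z.2 - w.2| ^ ((1 : ℝ) / 2)

/-- `[𝔇^k u]_{α,Q} ≤ B`: the sum over the components `D_x^{k-2q} ∂_t^q u` of their
parabolic `α`-Hölder seminorms over `Q` is at most `B`. -/
def frakDHolderLE (d : ℕ) (u : EuclideanSpace ℝ (Fin d) × ℝ → ℝ) (k : ℕ) (α : ℝ)
    (Q : Set (EuclideanSpace ℝ (Fin d) × ℝ)) (B : ℝ) : Prop :=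
  ∃ M : ℕ → ℝ, (∀ q, 0 ≤ M q) ∧ (∑ q ∈ Finset.range (k / 2 + 1), M q) ≤ B ∧
    ∀ q ∈ Finset.range (k / 2 + 1), ∀ z ∈ Q, ∀ w ∈ Q,
      ‖spaceTimeDeriv d u (k - 2 * q) q z.1 z.2 - spaceTimeDeriv d u (k - 2 * q) q w.1 w.2‖
        ≤ M q * parabolicDist d z w ^ α


open scoped ContDiff

section helpers

variable {V : Type*} [NormedAddCommGroup V] [NormedSpace ℝ V]

/-- Iterated directional derivatives along a list of vectors. -/
noncomputable def dirD : List V → (V → ℝ) → V → ℝ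
  | [], f => f
  | v :: l, f => fun z => fderiv ℝ (dirD l f) z v

/-- The zonotope spanned by a list of vectors. -/
def zonot : List V → V → Set V
  | [], z => {z}
  | v :: l, z => {w | ∃ z' ∈ zonot l z, ∃ θ : ℝ, 0 ≤ θ ∧ θ ≤ 1 ∧ w = z' + θ • v}

lemma dirD_smooth (l : List V) (f : V → ℝ) (hf : ContDiff ℝ ∞ f) : ContDiff ℝ ∞ (dirD l f) := by
  induction l with
  | nil => exact hf
  | cons v l ih =>
    have := ih.fderiv_right (m := ∞) (by simp)
    exact this.clm_apply contDiff_const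

lemma dirD_diff (l : List V) (f : V → ℝ) (hf : ContDiff ℝ ∞ f) : Differentiable ℝ (dirD l f) :=
  (dirD_smooth l f hf).differentiable (by simp)

lemma dirD_append (l₁ l₂ : List V) (f : V → ℝ) : dirD (l₁ ++ l₂) f = dirD l₁ (dirD l₂ f) := by
  induction l₁ with
  | nil => rfl
  | cons v l ih => simp only [List.cons_append, dirD, ih]

lemma dirD_const_mul (l : List V) (f : V → ℝ) (hf : ContDiff ℝ ∞ f) (c : ℝ) :
    dirD l (fun z => c * f z) = fun z => c * dirD l f z := by
  induction l with
  | nil => rfl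
  | cons v l ih =>
    funext z
    simp only [dirD, ih]
    rw [fderiv_const_mul (dirD_diff l f hf z)]
    simp

lemma dirD_translate (l : List V) (f : V → ℝ) (hf : ContDiff ℝ ∞ f) (v : V) :
    dirD l (fun z => f (z + v) - f z) = fun z => dirD l f (z + v) - dirD l f z := by
  induction l with
  | nil => rfl
  | cons a l ih =>
    funext z
    simp only [dirD, ih]
    have h := dirD_diff l f hf
    have h' : DifferentiableAt ℝ (fun z => dirD l f (z + v)) z :=
      (h (z + v)).comp z (differentiableAt_id.add_const v)
    rw [fderiv_fun_sub h' (h z), fderiv_comp_add_right]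
    simp

lemma mvt_dir (g : V → ℝ) (hg : Differentiable ℝ g) (z v : V) :
    ∃ θ : ℝ, 0 ≤ θ ∧ θ ≤ 1 ∧ g (z + v) - g z = fderiv ℝ g (z + θ • v) v := by
  have hd : ∀ x : ℝ, HasDerivAt (fun s : ℝ => g (z + s • v)) (fderiv ℝ g (z + x • v) v) x := by
    intro x
    have h1 : HasDerivAt (fun s : ℝ => z + s • v) v x := by
      simpa using ((hasDerivAt_id x).smul_const v).const_add z
    exact (hg _).hasFDerivAt.comp_hasDerivAt x h1
  obtain ⟨c, hc, h⟩ := exists_hasDerivAt_eq_slope (fun s : ℝ => g (z + s • v)) _ zero_lt_one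
    (fun x _ => (hd x).continuousAt.continuousWithinAt) (fun x _ => hd x)
  refine ⟨c, hc.1.le, hc.2.le, ?_⟩
  rw [h]; simp

lemma core_fd (l : List V) : ∀ (f : V → ℝ), ContDiff ℝ ∞ f → ∀ (z : V) (A : ℝ),
    (∀ w ∈ zonot l z, |f w| ≤ A) → ∃ w ∈ zonot l z, |dirD l f w| ≤ 2 ^ l.length * A := by
  induction l with
  | nil => intro f _ z A h; exact ⟨z, rfl, by simpa [dirD] using h z rfl⟩
  | cons v l ih =>
    intro f hf z A h
    have hs : ContDiff ℝ ∞ (fun z => f (z + v) - f z) :=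
      (hf.comp (contDiff_id.add contDiff_const)).sub hf
    obtain ⟨w, hw, hb⟩ := ih (fun z => f (z + v) - f z) hs z (2 * A) (by
      intro w hw
      have h1 := h (w + v) ⟨w, hw, 1, by simp, by simp, by simp⟩
      have h2 := h w ⟨w, hw, 0, by simp, by simp, by simp⟩
      have := abs_sub (f (w + v)) (f w)
      linarith)
    rw [dirD_translate l f hf] at hb
    obtain ⟨θ, h0, h1, he⟩ := mvt_dir (dirD l f) (dirD_diff l f hf) w v
    refine ⟨w + θ • v, ⟨w, hw, θ, h0, h1, rfl⟩, ?_⟩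
    simp only [dirD, List.length_cons]
    rw [← he, pow_succ, mul_assoc]
    exact hb

lemma multi_le {p : ℕ} (T : ContinuousMultilinearMap ℝ (fun _ : Fin p => V) ℝ) (K : ℝ)
    (hK : 0 ≤ K) (h : ∀ e : Fin p → V, (∀ i, ‖e i‖ ≤ 1) → |T e| ≤ K) : ‖T‖ ≤ K := by
  refine ContinuousMultilinearMap.opNorm_le_bound hK ?_
  intro e
  by_cases h0 : ∃ i, e i = 0
  · obtain ⟨i, hi⟩ := h0
    rw [T.map_coord_zero i hi, norm_zero]
    positivity
  · push Not at h0
    have he : e = fun i => ‖e i‖ • (‖e i‖⁻¹ • e i) := by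
      funext i
      rw [smul_smul, mul_inv_cancel₀ (norm_ne_zero_iff.2 (h0 i)), one_smul]
    have hb := h (fun i => ‖e i‖⁻¹ • e i) (by
      intro i
      rw [norm_smul, norm_inv, norm_norm, inv_mul_cancel₀ (norm_ne_zero_iff.2 (h0 i))])
    have h2 : T e = (∏ i, ‖e i‖) • T (fun i => ‖e i‖⁻¹ • e i) := by
      rw [← T.map_smul_univ, ← he]
    rw [h2, norm_smul, mul_comm, Real.norm_eq_abs, Real.norm_eq_abs,
      abs_of_nonneg (Finset.prod_nonneg fun i _ => norm_nonneg _)]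
    gcongr

end helpers

section spacetime

variable {E : Type*} [NormedAddCommGroup E] [NormedSpace ℝ E]

lemma zonot_fst (l : List (E × ℝ)) (z w : E × ℝ) (hw : w ∈ zonot l z) :
    ‖w.1 - z.1‖ ≤ (l.map (fun v => ‖v.1‖)).sum := by
  induction l generalizing w with
  | nil => 
    have : w = z := hw
    simp [this]
  | cons v l ih =>
    obtain ⟨z', hz', θ, h0, h1, rfl⟩ := hw
    have := ih z' hz'
    have e : (z' + θ • v).1 - z.1 = (z'.1 - z.1) + θ • v.1 := by
      simp; abel
    rw [e]
    refine (norm_add_le _ _).trans ?_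
    rw [norm_smul, Real.norm_eq_abs, abs_of_nonneg h0]
    simp only [List.map_cons, List.sum_cons]
    have := mul_le_of_le_one_left (norm_nonneg v.1) h1
    linarith

lemma zonot_snd (σ : ℝ) (l : List (E × ℝ)) (hl : ∀ v ∈ l, 0 ≤ σ * v.2) (z w : E × ℝ)
    (hw : w ∈ zonot l z) :
    0 ≤ σ * (w.2 - z.2) ∧ σ * (w.2 - z.2) ≤ (l.map (fun v => σ * v.2)).sum := by
  induction l generalizing w with
  | nil => 
    have : w = z := hw
    simp [this]
  | cons v l ih =>
    obtain ⟨z', hz', θ, h0, h1, rfl⟩ := hw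
    obtain ⟨i1, i2⟩ := ih (fun v hv => hl v (List.mem_cons_of_mem _ hv)) z' hz'
    have hv := hl v List.mem_cons_self
    have e : σ * ((z' + θ • v).2 - z.2) = σ * (z'.2 - z.2) + θ * (σ * v.2) := by
      simp; ring
    rw [e]
    simp only [List.map_cons, List.sum_cons]
    have := mul_le_of_le_one_left hv h1
    have := mul_nonneg h0 hv
    constructor <;> linarith

lemma fderiv_slice_fst (F : E × ℝ → ℝ) (hF : Differentiable ℝ F) (x : E) (s : ℝ) (v : E) :
    fderiv ℝ F (x, s) (v, 0) = fderiv ℝ (fun y => F (y, s)) x v := by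
  have h : HasFDerivAt (fun y : E => (y, s)) (ContinuousLinearMap.inl ℝ E ℝ) x :=
    hasFDerivAt_prodMk_left x s
  have := (hF (x, s)).hasFDerivAt.comp x h
  have h2 := this.fderiv
  simp only [Function.comp_def] at h2
  rw [h2]; simp

lemma fderiv_slice_snd (F : E × ℝ → ℝ) (hF : Differentiable ℝ F) (x : E) (s : ℝ) (c : ℝ) :
    fderiv ℝ F (x, s) (0, c) = c * deriv (fun y => F (x, y)) s := by
  have h : HasFDerivAt (fun y : ℝ => (x, y)) (ContinuousLinearMap.inr ℝ E ℝ) s :=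
    hasFDerivAt_prodMk_right x s
  have := (hF (x, s)).hasFDerivAt.comp s h
  have h2 := this.fderiv
  simp only [Function.comp_def] at h2
  rw [← fderiv_apply_one_eq_deriv, h2, ← smul_eq_mul, ← map_smul]; simp

lemma dirD_time (q : ℕ) (c : ℝ) (f : E × ℝ → ℝ) (hf : ContDiff ℝ ∞ f) (x : E) (s : ℝ) :
    dirD (List.replicate q ((0 : E), c)) f (x, s) = c ^ q * iteratedDeriv q (fun τ => f (x, τ)) s := by
  induction q generalizing s with
  | zero => simp [dirD]
  | succ q ih =>
    rw [List.replicate_succ, dirD]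
    beta_reduce
    rw [fderiv_slice_snd _ (dirD_diff _ f hf), iteratedDeriv_succ]
    have : (fun y => dirD (List.replicate q ((0 : E), c)) f (x, y)) =
      fun y => c ^ q * iteratedDeriv q (fun τ => f (x, τ)) y := funext ih
    rw [this, deriv_const_mul_field]
    ring

lemma dirD_space (p : ℕ) (e : Fin p → E) (f : E × ℝ → ℝ) (hf : ContDiff ℝ ∞ f) (x : E) (s : ℝ) :
    dirD (List.ofFn (fun i => (e i, (0 : ℝ)))) f (x, s) = iteratedFDeriv ℝ p (fun y => f (y, s)) x e := by
  have hs : ContDiff ℝ ∞ (fun y => f (y, s)) := hf.comp (contDiff_id.prodMk contDiff_const)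
  induction p generalizing x with
  | zero => simp [dirD]
  | succ p ih =>
    rw [List.ofFn_succ, dirD]
    beta_reduce
    rw [fderiv_slice_fst _ (dirD_diff _ f hf), iteratedFDeriv_succ_apply_left]
    have : (fun y => dirD (List.ofFn (fun i : Fin p => (e i.succ, (0 : ℝ)))) f (y, s)) =
      fun y => iteratedFDeriv ℝ p (fun y => f (y, s)) y (Fin.tail e) :=
      funext (fun y => ih (Fin.tail e) y)
    rw [this]
    have hd : DifferentiableAt ℝ (iteratedFDeriv ℝ p (fun y => f (y, s))) x :=
      hs.differentiable_iteratedFDeriv (by exact_mod_cast WithTop.coe_lt_top _) x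
    have := (hd.hasFDerivAt.continuousMultilinear_apply_const (Fin.tail e)).fderiv
    rw [this]
    simp
end spacetime

section main
variable {d : ℕ}

lemma dirD_std (p q : ℕ) (c : ℝ) (e : Fin p → EuclideanSpace ℝ (Fin d))
    (f : EuclideanSpace ℝ (Fin d) × ℝ → ℝ) (hf : ContDiff ℝ ∞ f) (w : EuclideanSpace ℝ (Fin d) × ℝ) :
    dirD (List.ofFn (fun i => (e i, (0 : ℝ))) ++ List.replicate q ((0 : EuclideanSpace ℝ (Fin d)), c)) f w
      = c ^ q * spaceTimeDeriv d f p q w.1 w.2 e := by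
  obtain ⟨x, s⟩ := w
  have h1 : dirD (List.replicate q ((0 : EuclideanSpace ℝ (Fin d)), c)) f = fun z =>
      c ^ q * dirD (List.replicate q ((0 : EuclideanSpace ℝ (Fin d)), 1)) f z := by
    funext ⟨x, s⟩
    simp [dirD_time _ _ f hf]
  rw [dirD_append, h1, dirD_const_mul _ _ (dirD_smooth _ f hf)]
  simp only
  rw [dirD_space _ _ _ (dirD_smooth _ f hf)]
  simp [dirD_time _ _ f hf, spaceTimeDeriv]

lemma std_shift (q p : ℕ) (f : EuclideanSpace ℝ (Fin d) × ℝ → ℝ) (hf : ContDiff ℝ ∞ f)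
    (x : EuclideanSpace ℝ (Fin d)) (s : ℝ) :
    spaceTimeDeriv d (dirD (List.replicate q ((0 : EuclideanSpace ℝ (Fin d)), 1)) f) p 0 x s
      = spaceTimeDeriv d f p q x s := by
  simp [dirD_time _ _ f hf, spaceTimeDeriv]

lemma step_G (p q : ℕ) (ρ' ρ : ℝ) (hρ : ρ' < ρ) : ∃ K : ℝ, 0 ≤ K ∧
    ∀ f : EuclideanSpace ℝ (Fin d) × ℝ → ℝ, ContDiff ℝ ∞ f → ∀ t ε A B : ℝ, 0 < ε → ε ≤ 1 →
    0 ≤ A → 0 ≤ B → ∀ z ∈ parabolicCylinder d ρ' t,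
    (∀ w ∈ parabolicCylinder d ρ t, |f w| ≤ A) →
    (∀ w ∈ parabolicCylinder d ρ t, ‖w.1 - z.1‖ ≤ p * ε → |w.2 - z.2| ≤ q * ε ^ 2 →
      ‖spaceTimeDeriv d f p q w.1 w.2 - spaceTimeDeriv d f p q z.1 z.2‖ ≤ B) →
    ‖spaceTimeDeriv d f p q z.1 z.2‖ ≤ K * (ε ^ (p + 2 * q))⁻¹ * A + B := by
  obtain ⟨δ, hδ0, hδ1, hδp, hδq⟩ : ∃ δ : ℝ, 0 < δ ∧ δ ≤ 1 ∧ p * δ ≤ ρ - ρ' ∧ q * δ ≤ 1 / 2 := by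
    have hp : (0:ℝ) < p + 1 := by positivity
    have hq : (0:ℝ) < q + 1 := by positivity
    have hr : 0 < ρ - ρ' := by linarith
    refine ⟨min 1 (min ((ρ - ρ') / (p + 1)) ((1 / 2) / (q + 1))), by positivity, min_le_left _ _, ?_, ?_⟩
    · have : min 1 (min ((ρ - ρ') / (p + 1)) ((1 / 2) / ((q:ℝ) + 1))) ≤ (ρ - ρ') / (p + 1) :=
        (min_le_right _ _).trans (min_le_left _ _)
      calc (p:ℝ) * _ ≤ (p + 1) * ((ρ - ρ') / (p + 1)) := by gcongr; linarith
        _ = _ := by field_simp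
    · have : min 1 (min ((ρ - ρ') / (p + 1)) ((1 / 2) / ((q:ℝ) + 1))) ≤ (1 / 2) / (q + 1) :=
        (min_le_right _ _).trans (min_le_right _ _)
      calc (q:ℝ) * _ ≤ (q + 1) * ((1 / 2) / (q + 1)) := by gcongr; linarith
        _ = _ := by field_simp
  refine ⟨2 ^ (p + q) * (δ ^ (p + 2 * q))⁻¹, by positivity, ?_⟩
  intro f hf t ε A B hε hε1 hA hB z hz hfA hfB
  refine multi_le _ _ (by positivity) ?_
  intro e he
  obtain ⟨σ, hσ1, hσ⟩ : ∃ σ : ℝ, (σ = 1 ∨ σ = -1) ∧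
      ∀ s : ℝ, 0 ≤ σ * (s - z.2) → σ * (s - z.2) ≤ 1 / 2 → t - 1 ≤ s ∧ s ≤ t := by
    obtain ⟨_, hz1, hz2⟩ := hz
    by_cases h : z.2 ≤ t - 1 / 2
    · exact ⟨1, Or.inl rfl, fun s h1 h2 => ⟨by linarith, by linarith⟩⟩
    · exact ⟨-1, Or.inr rfl, fun s h1 h2 => ⟨by linarith, by linarith⟩⟩
  have hσσ : σ * σ = 1 := by rcases hσ1 with h | h <;> rw [h] <;> norm_num
  have hσa : |σ| = 1 := by rcases hσ1 with h | h <;> rw [h] <;> norm_num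
  set r := δ * ε with hr
  have hr0 : 0 < r := by positivity
  have hrε : r ≤ ε := by rw [hr]; exact mul_le_of_le_one_left hε.le hδ1
  have hrδ : r ≤ δ := by rw [hr]; exact mul_le_of_le_one_right hδ0.le hε1
  have hr1 : r ≤ 1 := hrδ.trans hδ1
  set l : List (EuclideanSpace ℝ (Fin d) × ℝ) :=
    List.ofFn (fun i => (r • e i, (0 : ℝ))) ++ List.replicate q ((0 : EuclideanSpace ℝ (Fin d)), σ * r ^ 2)
    with hl
  have hlen : l.length = p + q := by simp [hl]
  have hz1 : ∀ w ∈ zonot l z, ‖w.1 - z.1‖ ≤ p * r := by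
    intro w hw
    refine (zonot_fst l z w hw).trans ?_
    simp only [hl, List.map_append, List.sum_append, List.map_ofFn, List.sum_ofFn, List.map_replicate,
      List.sum_replicate, norm_zero, smul_zero, add_zero, Function.comp_def]
    calc ∑ i, ‖r • e i‖ ≤ ∑ i : Fin p, r := by
          refine Finset.sum_le_sum fun i _ => ?_
          rw [norm_smul, Real.norm_eq_abs, abs_of_pos hr0]
          exact mul_le_of_le_one_right hr0.le (he i)
      _ = p * r := by simp
  have hz2 : ∀ w ∈ zonot l z, 0 ≤ σ * (w.2 - z.2) ∧ σ * (w.2 - z.2) ≤ q * r ^ 2 := by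
    intro w hw
    have := zonot_snd σ l (by
      intro v hv
      simp only [hl, List.mem_append, List.mem_ofFn, List.mem_replicate] at hv
      rcases hv with ⟨i, rfl⟩ | ⟨_, rfl⟩
      · simp
      · simp only [← mul_assoc, hσσ]; positivity) z w hw
    refine ⟨this.1, this.2.trans (le_of_eq ?_)⟩
    simp [hl, Function.comp_def, ← mul_assoc, hσσ]
  have hsub : ∀ w ∈ zonot l z, w ∈ parabolicCylinder d ρ t := by
    intro w hw
    have h1 := hz1 w hw
    have h2 := hz2 w hw
    have h3 : (p:ℝ) * r ≤ p * δ := by gcongr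
    have h4 : (q:ℝ) * r ^ 2 ≤ q * δ := by
      gcongr; nlinarith
    refine ⟨?_, hσ w.2 h2.1 (by linarith)⟩
    have h5 : ‖w.1‖ ≤ ‖w.1 - z.1‖ + ‖z.1‖ := by
      simpa using norm_add_le (w.1 - z.1) z.1
    have := hz.1
    linarith
  obtain ⟨w, hw, hb⟩ := core_fd l f hf z A (fun w hw => hfA w (hsub w hw))
  have hwB := hfB w (hsub w hw) ((hz1 w hw).trans (by gcongr)) (by
    have h2 := hz2 w hw
    have : |w.2 - z.2| = σ * (w.2 - z.2) := by
      rw [← abs_of_nonneg h2.1, abs_mul, hσa, one_mul]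
    rw [this]
    exact h2.2.trans (by gcongr))
  rw [hlen, hl, dirD_std p q _ (fun i => r • e i) f hf, ContinuousMultilinearMap.map_smul_univ] at hb
  simp only [Finset.prod_const, Finset.card_univ, Fintype.card_fin, smul_eq_mul, abs_mul, abs_pow, hσa,
    one_mul, abs_of_pos hr0] at hb
  have hb' : |spaceTimeDeriv d f p q w.1 w.2 e| ≤ 2 ^ (p + q) * A * (r ^ (p + 2 * q))⁻¹ := by
    rw [← div_eq_mul_inv, le_div_iff₀ (by positivity)]
    calc _ = (r ^ 2) ^ q * (r ^ p * |spaceTimeDeriv d f p q w.1 w.2 e|) := by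
          rw [pow_add, pow_mul]; ring
      _ ≤ _ := hb
  have hdif : |spaceTimeDeriv d f p q w.1 w.2 e - spaceTimeDeriv d f p q z.1 z.2 e| ≤ B := by
    have h1 := (spaceTimeDeriv d f p q w.1 w.2 - spaceTimeDeriv d f p q z.1 z.2).le_opNorm e
    rw [sub_apply, Real.norm_eq_abs] at h1
    have h2 : ∏ i, ‖e i‖ ≤ 1 := Finset.prod_le_one (fun i _ => norm_nonneg _) (fun i _ => he i)
    refine h1.trans ((mul_le_of_le_one_right (norm_nonneg _) h2).trans hwB)
  have e1 : 2 ^ (p + q) * A * (r ^ (p + 2 * q))⁻¹ =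
      2 ^ (p + q) * (δ ^ (p + 2 * q))⁻¹ * (ε ^ (p + 2 * q))⁻¹ * A := by
    rw [hr, mul_pow, mul_inv]; ring
  rw [← e1]
  have := abs_sub_abs_le_abs_sub (spaceTimeDeriv d f p q z.1 z.2 e) (spaceTimeDeriv d f p q w.1 w.2 e)
  rw [abs_sub_comm] at this
  linarith

end main

section assembly
variable {d : ℕ}

/-- Uniform exponential bound for one derivative component. -/
def stdBd (d : ℕ) (u : EuclideanSpace ℝ (Fin d) × ℝ → ℝ) (a lam ρ : ℝ) (p q : ℕ) : Prop :=
  ∃ K : ℝ, 0 ≤ K ∧ ∀ t ≥ (1 : ℝ), ∀ z ∈ parabolicCylinder d ρ t,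
    ‖spaceTimeDeriv d u p q z.1 z.2‖ ≤ K * Real.exp (-(t / 2) * (a - ((p + 2 * q : ℕ) : ℝ) * lam))

lemma eps_pow (t lam : ℝ) (n : ℕ) :
    (Real.exp (-(t / 2) * lam) ^ n)⁻¹ = Real.exp (t / 2 * (n * lam)) := by
  rw [← Real.exp_nat_mul, ← Real.exp_neg]; congr 1; ring

lemma top_bd (u : EuclideanSpace ℝ (Fin d) × ℝ → ℝ) (hu : ContDiff ℝ ∞ u) (ρ a α C₀ : ℝ)
    (hα : 0 < α) (hC₀ : 0 < C₀) (p q m : ℕ) (hm : p + 2 * q = m) (ham : 0 ≤ a - 10 + m)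
    (h1 : ∀ t ≥ (1 : ℝ), ∀ z ∈ parabolicCylinder d ρ t, |u z| ≤ C₀ * Real.exp (-(t / 2) * a))
    (h3 : ∀ t ≥ (1 : ℝ), frakDHolderLE d u m α (parabolicCylinder d ρ t)
        (C₀ * Real.exp (((m : ℝ) - 10) * t / 2))) :
    ∀ ρ' < ρ, stdBd d u a ((a - 10 + m) / (m + α)) ρ' p q := by
  intro ρ' hρ
  obtain ⟨K, hK, hG⟩ := step_G (d := d) p q ρ' ρ hρ
  have hmα : (0:ℝ) < m + α := by positivity
  set lam := (a - 10 + m) / (m + α) with hlam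
  have hlam0 : 0 ≤ lam := by positivity
  have hlamE : lam * (m + α) = a - 10 + m := by rw [hlam]; field_simp
  refine ⟨K * C₀ + C₀ * (m : ℝ) ^ α, by positivity, ?_⟩
  intro t ht z hz
  set ε := Real.exp (-(t / 2) * lam) with hε
  have hε0 : 0 < ε := Real.exp_pos _
  have hε1 : ε ≤ 1 := Real.exp_le_one_iff.2 (by nlinarith)
  obtain ⟨M, hM0, hMs, hM⟩ := h3 t ht
  have hzQ : z ∈ parabolicCylinder d ρ t := ⟨hz.1.trans hρ.le, hz.2⟩
  have hq : q ∈ Finset.range (m / 2 + 1) := by simp; omega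
  have hp : m - 2 * q = p := by omega
  have key := hG u hu t ε (C₀ * Real.exp (-(t / 2) * a))
    (C₀ * Real.exp (((m : ℝ) - 10) * t / 2) * (m * ε) ^ α) hε0 hε1 (by positivity) (by positivity)
    z hz (h1 t ht) (by
      intro w hw hw1 hw2
      have := hM q hq w hw z hzQ
      rw [hp] at this
      refine this.trans ?_
      have hMq : M q ≤ C₀ * Real.exp (((m : ℝ) - 10) * t / 2) :=
        (Finset.single_le_sum (fun i _ => hM0 i) hq).trans hMs
      have hdist : parabolicDist d w z ≤ m * ε := by
        unfold parabolicDist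
        have : |w.2 - z.2| ^ ((1:ℝ) / 2) ≤ q * ε := by
          rw [← Real.sqrt_eq_rpow]
          apply Real.sqrt_le_iff.2
          refine ⟨by positivity, hw2.trans ?_⟩
          rw [mul_pow]
          gcongr
          have : q ≤ q ^ 2 := Nat.le_self_pow (by norm_num) q
          exact_mod_cast this
        have hm' : (m:ℝ) = p + 2 * q := by rw [← hm]; push_cast; ring
        rw [hm']
        have : 0 ≤ q * ε := by positivity
        nlinarith
      have hd0 : 0 ≤ parabolicDist d w z := by unfold parabolicDist; positivity
      gcongr)
  refine key.trans (le_of_eq ?_)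
  rw [hm, eps_pow, Real.mul_rpow (by positivity) hε0.le, hε, ← Real.exp_mul, add_mul]
  congr 1
  · rw [show K * Real.exp (t / 2 * (m * lam)) * (C₀ * Real.exp (-(t / 2) * a)) =
      K * C₀ * (Real.exp (t / 2 * (m * lam)) * Real.exp (-(t / 2) * a)) by ring, ← Real.exp_add]
    congr 2; ring
  · rw [show C₀ * Real.exp (((m : ℝ) - 10) * t / 2) * ((m : ℝ) ^ α * Real.exp (-(t / 2) * lam * α)) =
      C₀ * (m : ℝ) ^ α * (Real.exp (((m : ℝ) - 10) * t / 2) * Real.exp (-(t / 2) * lam * α)) by ring,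
      ← Real.exp_add]
    congr 2
    linear_combination (-(t / 2)) * hlamE

lemma std_zero_sub (u : EuclideanSpace ℝ (Fin d) × ℝ → ℝ) (q : ℕ) (x y : EuclideanSpace ℝ (Fin d))
    (s r : ℝ) : ‖spaceTimeDeriv d u 0 q x s - spaceTimeDeriv d u 0 q y r‖ =
      |iteratedDeriv q (fun τ => u (x, τ)) s - iteratedDeriv q (fun τ => u (y, τ)) r| := by
  simp only [spaceTimeDeriv, iteratedFDeriv_zero_eq_comp, Function.comp_apply]
  rw [← map_sub, LinearIsometryEquiv.norm_map, Real.norm_eq_abs]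

lemma std_zero_norm (u : EuclideanSpace ℝ (Fin d) × ℝ → ℝ) (q : ℕ) (x : EuclideanSpace ℝ (Fin d))
    (s : ℝ) : ‖spaceTimeDeriv d u 0 q x s‖ = |iteratedDeriv q (fun τ => u (x, τ)) s| := by
  simp only [spaceTimeDeriv, norm_iteratedFDeriv_zero, Real.norm_eq_abs]

lemma time_step (u : EuclideanSpace ℝ (Fin d) × ℝ → ℝ) (hu : ContDiff ℝ ∞ u) (ρ a lam C₀ : ℝ)
    (hlam : 0 ≤ lam) (hC₀ : 0 < C₀) (q : ℕ)
    (h1 : ∀ t ≥ (1 : ℝ), ∀ z ∈ parabolicCylinder d ρ t, |u z| ≤ C₀ * Real.exp (-(t / 2) * a))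
    (h : ∀ ρ' < ρ, stdBd d u a lam ρ' 0 (q + 1)) : ∀ ρ' < ρ, stdBd d u a lam ρ' 0 q := by
  intro ρ' hρ
  set ρ'' := (ρ' + ρ) / 2 with hρ''
  have hl : ρ' < ρ'' := by rw [hρ'']; linarith
  have hr : ρ'' < ρ := by rw [hρ'']; linarith
  obtain ⟨K1, hK1, hb⟩ := h ρ'' hr
  obtain ⟨K, hK, hG⟩ := step_G (d := d) 0 q ρ' ρ'' hl
  refine ⟨K * C₀ + q * K1, by positivity, ?_⟩
  intro t ht z hz
  set ε := Real.exp (-(t / 2) * lam) with hε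
  have hε0 : 0 < ε := Real.exp_pos _
  have hε1 : ε ≤ 1 := Real.exp_le_one_iff.2 (by nlinarith)
  set X := Real.exp (-(t / 2) * (a - ((0 + 2 * (q + 1) : ℕ) : ℝ) * lam)) with hX
  have hX0 : 0 < X := Real.exp_pos _
  have key := hG u hu t ε (C₀ * Real.exp (-(t / 2) * a)) (K1 * X * (q * ε ^ 2)) hε0 hε1
    (by positivity) (by positivity) z hz (fun w hw => h1 t ht w ⟨hw.1.trans hr.le, hw.2⟩) (by
      intro w hw hw1 hw2
      have hx : w.1 = z.1 := by
        have : ‖w.1 - z.1‖ ≤ 0 := by simpa using hw1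
        exact sub_eq_zero.1 (norm_le_zero_iff.1 this)
      rw [hx, std_zero_sub]
      have hs : ContDiff ℝ ∞ (fun τ => u (z.1, τ)) := hu.comp (contDiff_const.prodMk contDiff_id)
      have hd : ∀ s ∈ Set.Icc (t - 1) t, DifferentiableAt ℝ (iteratedDeriv q (fun τ => u (z.1, τ))) s :=
        fun s _ => hs.differentiable_iteratedDeriv q (by exact_mod_cast WithTop.coe_lt_top _) s
      have := Convex.norm_image_sub_le_of_norm_deriv_le (C := K1 * X) hd (by
        intro s hs'
        rw [← iteratedDeriv_succ, Real.norm_eq_abs, ← std_zero_norm]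
        exact hb t ht (z.1, s) ⟨hz.1.trans hl.le, hs'⟩) (convex_Icc _ _) hz.2 hw.2
      rw [Real.norm_eq_abs, Real.norm_eq_abs] at this
      exact this.trans (by gcongr))
  refine key.trans (le_of_eq ?_)
  rw [eps_pow, hε, ← Real.exp_nat_mul, add_mul, hX]
  congr 1
  · rw [show ∀ x y : ℝ, K * x * (C₀ * y) = K * C₀ * (x * y) by intros; ring, ← Real.exp_add]
    congr 2; ring
  · rw [show ∀ x y : ℝ, K1 * x * (q * y) = q * K1 * (x * y) by intros; ring, ← Real.exp_add]
    congr 2; push_cast; ring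

lemma space_step (u : EuclideanSpace ℝ (Fin d) × ℝ → ℝ) (hu : ContDiff ℝ ∞ u) (ρ a lam : ℝ)
    (hlam : 0 ≤ lam) (p q : ℕ)
    (h0 : ∀ ρ' < ρ, stdBd d u a lam ρ' 0 q)
    (h : ∀ ρ' < ρ, stdBd d u a lam ρ' (p + 1) q) : ∀ ρ' < ρ, stdBd d u a lam ρ' p q := by
  intro ρ' hρ
  set ρ'' := (ρ' + ρ) / 2 with hρ''
  have hl : ρ' < ρ'' := by rw [hρ'']; linarith
  have hr : ρ'' < ρ := by rw [hρ'']; linarith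
  obtain ⟨K0, hK0, hb0⟩ := h0 ρ'' hr
  obtain ⟨K1, hK1, hb⟩ := h ρ'' hr
  obtain ⟨K, hK, hG⟩ := step_G (d := d) p 0 ρ' ρ'' hl
  refine ⟨K * K0 + p * K1, by positivity, ?_⟩
  intro t ht z hz
  set ε := Real.exp (-(t / 2) * lam) with hε
  have hε0 : 0 < ε := Real.exp_pos _
  have hε1 : ε ≤ 1 := Real.exp_le_one_iff.2 (by nlinarith)
  set X := Real.exp (-(t / 2) * (a - ((p + 1 + 2 * q : ℕ) : ℝ) * lam)) with hX
  set Y := Real.exp (-(t / 2) * (a - ((0 + 2 * q : ℕ) : ℝ) * lam)) with hY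
  have hX0 : 0 < X := Real.exp_pos _
  have hY0 : 0 < Y := Real.exp_pos _
  have hW := dirD_smooth (List.replicate q ((0 : EuclideanSpace ℝ (Fin d)), (1:ℝ))) u hu
  have key := hG _ hW t ε (K0 * Y) (K1 * X * (p * ε)) hε0 hε1
    (by positivity) (by positivity) z hz (fun w hw => by
      have := hb0 t ht w hw
      rw [std_zero_norm] at this
      rw [show w = (w.1, w.2) from rfl, dirD_time _ _ u hu, one_pow, one_mul]
      exact this) (by
      intro w hw hw1 hw2
      have hx : w.2 = z.2 := by
        have : |w.2 - z.2| ≤ 0 := by simpa using hw2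
        exact sub_eq_zero.1 (abs_nonpos_iff.1 this)
      rw [hx]
      set g := fun y => iteratedDeriv 0 (fun τ =>
        dirD (List.replicate q ((0 : EuclideanSpace ℝ (Fin d)), (1:ℝ))) u (y, τ)) z.2 with hg
      have hs : ContDiff ℝ ∞ g := by
        simp only [hg, iteratedDeriv_zero]
        exact hW.comp (contDiff_id.prodMk contDiff_const)
      have hd : ∀ s ∈ Metric.closedBall (0 : EuclideanSpace ℝ (Fin d)) ρ'',
          DifferentiableAt ℝ (iteratedFDeriv ℝ p g) s :=
        fun s _ => hs.differentiable_iteratedFDeriv (by exact_mod_cast WithTop.coe_lt_top _) s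
      have := Convex.norm_image_sub_le_of_norm_fderiv_le (C := K1 * X) hd (by
        intro s hs'
        rw [norm_fderiv_iteratedFDeriv]
        have h2 := hb t ht (s, z.2) ⟨by simpa using hs', hz.2⟩
        rw [← std_shift _ _ u hu] at h2
        exact h2) (convex_closedBall _ _) (x := z.1) (y := w.1)
        (by simpa using hz.1.trans hl.le) (by simpa using hw.1)
      exact this.trans (by gcongr))
  rw [std_shift _ _ u hu] at key
  refine key.trans (le_of_eq ?_)
  rw [eps_pow, hε, add_mul, hX, hY]
  congr 1
  · rw [show ∀ x y : ℝ, K * x * (K0 * y) = K * K0 * (x * y) by intros; ring, ← Real.exp_add]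
    congr 2; push_cast; ring
  · rw [show ∀ x y : ℝ, K1 * x * (p * y) = p * K1 * (x * y) by intros; ring, ← Real.exp_add]
    congr 2; push_cast; ring

lemma low_bd (u : EuclideanSpace ℝ (Fin d) × ℝ → ℝ) (hu : ContDiff ℝ ∞ u) (ρ a lam C₀ : ℝ)
    (hlam : 0 ≤ lam) (hC₀ : 0 < C₀)
    (h1 : ∀ t ≥ (1 : ℝ), ∀ z ∈ parabolicCylinder d ρ t, |u z| ≤ C₀ * Real.exp (-(t / 2) * a))
    (h8 : ∀ p q, p + 2 * q = 8 → ∀ ρ' < ρ, stdBd d u a lam ρ' p q) :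
    ∀ p q, p + 2 * q ≤ 8 → ∀ ρ' < ρ, stdBd d u a lam ρ' p q := by
  have ht : ∀ j q, q + j = 4 → ∀ ρ' < ρ, stdBd d u a lam ρ' 0 q := by
    intro j
    induction j with
    | zero => intro q hq; exact h8 0 q (by omega)
    | succ j ih => intro q hq; exact time_step u hu ρ a lam C₀ hlam hC₀ q h1 (ih (q + 1) (by omega))
  have hs : ∀ j p q, p + 2 * q + j = 8 → ∀ ρ' < ρ, stdBd d u a lam ρ' p q := by
    intro j
    induction j with
    | zero => intro p q hq; exact h8 p q (by omega)
    | succ j ih =>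
      intro p q hq
      exact space_step u hu ρ a lam hlam p q (ht (4 - q) q (by omega)) (ih (p + 1) q (by omega))
  intro p q h
  exact hs (8 - (p + 2 * q)) p q (by omega)

lemma frak_bd (u : EuclideanSpace ℝ (Fin d) × ℝ → ℝ) (a lam ρ : ℝ) (ℓ : ℕ)
    (h : ∀ p q, p + 2 * q = ℓ → stdBd d u a lam ρ p q) :
    ∃ K : ℝ, 0 ≤ K ∧ ∀ t ≥ (1 : ℝ), ∀ z ∈ parabolicCylinder d ρ t,
      frakDNorm d u ℓ z ≤ K * Real.exp (-(t / 2) * (a - ℓ * lam)) := by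
  have h' : ∀ q : ℕ, ∃ K : ℝ, 0 ≤ K ∧ (2 * q ≤ ℓ → ∀ t ≥ (1 : ℝ), ∀ z ∈ parabolicCylinder d ρ t,
    ‖spaceTimeDeriv d u (ℓ - 2 * q) q z.1 z.2‖ ≤ K * Real.exp (-(t / 2) * (a - ℓ * lam))) := by
    intro q
    by_cases hq : 2 * q ≤ ℓ
    · obtain ⟨K, hK, hb⟩ := h (ℓ - 2 * q) q (by omega)
      refine ⟨K, hK, fun _ => ?_⟩
      rwa [show ℓ - 2 * q + 2 * q = ℓ by omega] at hb
    · exact ⟨0, le_rfl, fun h => absurd h hq⟩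
  choose K hK hb using h'
  refine ⟨∑ q ∈ Finset.range (ℓ / 2 + 1), K q, Finset.sum_nonneg fun i _ => hK i, ?_⟩
  intro t ht z hz
  unfold frakDNorm
  have h1 : Real.sqrt (∑ q ∈ Finset.range (ℓ / 2 + 1), ‖spaceTimeDeriv d u (ℓ - 2 * q) q z.1 z.2‖ ^ 2)
      ≤ ∑ q ∈ Finset.range (ℓ / 2 + 1), ‖spaceTimeDeriv d u (ℓ - 2 * q) q z.1 z.2‖ := by
    apply Real.sqrt_le_iff.2
    exact ⟨Finset.sum_nonneg fun i _ => norm_nonneg _,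
      Finset.sum_sq_le_sq_sum_of_nonneg fun i _ => norm_nonneg _⟩
  refine h1.trans ?_
  rw [Finset.sum_mul]
  refine Finset.sum_le_sum fun q hq => hb q ?_ t ht z hz
  simp at hq; omega

lemma unif_bd (u : EuclideanSpace ℝ (Fin d) × ℝ → ℝ) (ρ : ℝ) (S : ℕ → Prop) (N : ℕ)
    (hS : ∀ ℓ, S ℓ → ℓ ≤ N) (G : ℕ → ℝ → ℝ)
    (h : ∀ ℓ, S ℓ → ∃ K : ℝ, 0 ≤ K ∧ ∀ t ≥ (1 : ℝ), ∀ z ∈ parabolicCylinder d ρ t,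
      frakDNorm d u ℓ z ≤ K * Real.exp (G ℓ t)) :
    ∃ K : ℝ, 0 ≤ K ∧ ∀ ℓ, S ℓ → ∀ t ≥ (1 : ℝ), ∀ z ∈ parabolicCylinder d ρ t,
      frakDNorm d u ℓ z ≤ K * Real.exp (G ℓ t) := by
  have h' : ∀ ℓ, ∃ K : ℝ, 0 ≤ K ∧ (S ℓ → ∀ t ≥ (1 : ℝ), ∀ z ∈ parabolicCylinder d ρ t,
      frakDNorm d u ℓ z ≤ K * Real.exp (G ℓ t)) := by
    intro ℓ
    by_cases hℓ : S ℓ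
    · obtain ⟨K, hK, hb⟩ := h ℓ hℓ
      exact ⟨K, hK, fun _ => hb⟩
    · exact ⟨0, le_rfl, fun h => absurd h hℓ⟩
  choose K hK hb using h'
  refine ⟨∑ ℓ ∈ Finset.range (N + 1), K ℓ, Finset.sum_nonneg fun i _ => hK i, ?_⟩
  intro ℓ hℓ t ht z hz
  refine (hb ℓ hℓ t ht z hz).trans ?_
  have : K ℓ ≤ ∑ ℓ ∈ Finset.range (N + 1), K ℓ :=
    Finset.single_le_sum (fun i _ => hK i) (by have := hS ℓ hℓ; simp; omega)
  gcongr

end assembly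

/-- Interpolation estimates for the time derivatives of the third-order expansion
coefficients (estimate (5.13), part of Lemma 5.6 of the paper, in conditional form). -/
theorem interp_time_deriv_third_order_coefficients
    (d : ℕ) (hd : 1 ≤ d) (ρ ρ' : ℝ) (hρ' : 0 < ρ') (hρ : ρ' < ρ)
    (α : ℝ) (hα0 : 0 < α) (hα1 : α < 1) (k : ℕ) (hk : 10 ≤ k) (C₀ : ℝ) (hC₀ : 0 < C₀)
    (u : EuclideanSpace ℝ (Fin d) × ℝ → ℝ) (hu : ContDiff ℝ (⊤ : ℕ∞) u)
    (h1 : ∀ t ≥ (1 : ℝ), ∀ z ∈ parabolicCylinder d ρ t, |u z| ≤ C₀ * Real.exp (-(6 + α) * (1 - 2 / (12 + α)) * t / 2))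
    (h2 : ∀ t ≥ (1 : ℝ), frakDHolderLE d u 8 α (parabolicCylinder d ρ t) (C₀ * Real.exp (-t)))
    (h3 : ∀ t ≥ (1 : ℝ), ∀ ℓ : ℕ, 8 ≤ ℓ → ℓ ≤ 2 * k + 10 →
      frakDHolderLE d u ℓ α (parabolicCylinder d ρ t)
        (C₀ * Real.exp (((ℓ : ℝ) - 10) * t / 2))) :
    ∃ β, 0 < β ∧ β < α ∧ ∃ C > 0, ∀ t ≥ (1 : ℝ),
      (∀ ℓ : ℕ, ℓ ≤ 8 → ∀ z ∈ parabolicCylinder d ρ' t,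
        frakDNorm d u ℓ z ≤
          C * Real.exp (-(t / 2) * (5 + β - (3 + β) * (ℓ : ℝ) / (8 + α)))) ∧
      (∀ ℓ : ℕ, 8 ≤ ℓ → ℓ ≤ 2 * k + 10 → ∀ z ∈ parabolicCylinder d ρ' t,
        frakDNorm d u ℓ z ≤
          C * Real.exp (-(t / 2) * (5 - ((ℓ : ℝ) * ((ℓ : ℝ) - 5) - α * β) / ((ℓ : ℝ) + α)))) := by
  have hu' : ContDiff ℝ ∞ u := hu
  set β := α * (11 + α) / (12 + α) with hβ
  have h12 : 0 < 12 + α := by linarith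
  have hβ0 : 0 < β := by positivity
  have hβα : β < α := by
    rw [hβ, div_lt_iff₀ h12]; nlinarith
  have ha : (6 + α) * (1 - 2 / (12 + α)) = 5 + β := by
    rw [hβ]; field_simp; ring
  have h1' : ∀ t ≥ (1 : ℝ), ∀ z ∈ parabolicCylinder d ρ t,
      |u z| ≤ C₀ * Real.exp (-(t / 2) * (5 + β)) := by
    intro t ht z hz
    have := h1 t ht z hz
    rwa [show -(6 + α) * (1 - 2 / (12 + α)) * t / 2 = -(t / 2) * (5 + β) by rw [← ha]; ring] at this
  have htop : ∀ m : ℕ, 8 ≤ m → m ≤ 2 * k + 10 → ∀ p q, p + 2 * q = m → ∀ r < ρ,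
      stdBd d u (5 + β) ((5 + β - 10 + m) / (m + α)) r p q := by
    intro m hm8 hmk p q hm
    have : (8:ℝ) ≤ m := by exact_mod_cast hm8
    exact top_bd u hu' ρ (5 + β) α C₀ hα0 hC₀ p q m hm (by linarith) h1' (fun t ht => h3 t ht m hm8 hmk)
  have hlow := low_bd u hu' ρ (5 + β) ((5 + β - 10 + (8 : ℕ)) / ((8 : ℕ) + α)) C₀
    (by push_cast; apply div_nonneg <;> linarith) hC₀ h1' (htop 8 le_rfl (by omega))
  obtain ⟨K1, hK1, hb1⟩ := unif_bd u ρ' (fun ℓ => ℓ ≤ 8) 8 (fun _ h => h)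
    (fun ℓ t => -(t / 2) * (5 + β - ℓ * ((5 + β - 10 + (8 : ℕ)) / ((8 : ℕ) + α))))
    (fun ℓ hℓ => frak_bd u _ _ ρ' ℓ (fun p q h => hlow p q (by omega) ρ' hρ))
  obtain ⟨K2, hK2, hb2⟩ := unif_bd u ρ' (fun ℓ => 8 ≤ ℓ ∧ ℓ ≤ 2 * k + 10) (2 * k + 10) (fun _ h => h.2)
    (fun ℓ t => -(t / 2) * (5 + β - ℓ * ((5 + β - 10 + ℓ) / (ℓ + α))))
    (fun ℓ hℓ => frak_bd u _ _ ρ' ℓ (fun p q h => htop ℓ hℓ.1 hℓ.2 p q h ρ' hρ))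
  refine ⟨β, hβ0, hβα, K1 + K2 + 1, by positivity, fun t ht => ⟨?_, ?_⟩⟩
  · intro ℓ hℓ z hz
    refine (hb1 ℓ hℓ t ht z hz).trans ?_
    have e : -(t / 2) * (5 + β - ℓ * ((5 + β - 10 + (8 : ℕ)) / ((8 : ℕ) + α))) =
        -(t / 2) * (5 + β - (3 + β) * (ℓ : ℝ) / (8 + α)) := by
      push_cast; ring
    rw [e]
    gcongr
    linarith
  · intro ℓ hℓ hℓk z hz
    refine (hb2 ℓ ⟨hℓ, hℓk⟩ t ht z hz).trans ?_
    have hne : (ℓ : ℝ) + α ≠ 0 := by positivity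
    have e : -(t / 2) * (5 + β - ℓ * ((5 + β - 10 + ℓ) / (ℓ + α))) =
        -(t / 2) * (5 - ((ℓ : ℝ) * ((ℓ : ℝ) - 5) - α * β) / ((ℓ : ℝ) + α)) := by
      congr 1; clear_value β; field_simp; ring
    rw [e]
    gcongr
    linarith
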